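/- arXiv:1210.0278 — 7 statements merged into one kernel-verified Lean document; each statement's English description precedes it below -/
import Mathlib

section
/- Let q₁, q₂ ∈ ℝ³ with ‖q₁‖ = ‖q₂‖ = 1 be such that {q₁, q₂, e₃} is linearly independent, and let f : ℝ³ → ℝ be differentiable at ι(q₁,q₂). Then (q₁,q₂) is a critical point of f ∘ ι restricted to S² × S² if and only if fderiv f (ι(q₁,q₂)) = 0. -/
noncomputable section

/-- Standard dot product on ℝ³. -/
def dot (x y : Fin 3 → ℝ) : ℝ := ∑ i, x i * y i

/-- Third standard basis vector of ℝ³. -/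
def e3 : Fin 3 → ℝ := ![0, 0, 1]

/-- Orthogonal projection onto the horizontal plane. -/
def P3 (v : Fin 3 → ℝ) : Fin 3 → ℝ := v - dot e3 v • e3

/-- The invariant map `ι(q₁,q₂) = (⟨e₃,q₁⟩, ⟨e₃,q₂⟩, ⟨q₁, P₃ q₂⟩)`. -/
def iota (q : (Fin 3 → ℝ) × (Fin 3 → ℝ)) : Fin 3 → ℝ :=
  ![dot e3 q.1, dot e3 q.2, dot q.1 (P3 q.2)]

/-- `q` is a critical point of `F` restricted to `S² × S²`: `F` is differentiable at `q`
and its differential vanishes on all tangent vectors to the product of spheres. -/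
def IsCritPt (F : (Fin 3 → ℝ) × (Fin 3 → ℝ) → ℝ) (q : (Fin 3 → ℝ) × (Fin 3 → ℝ)) : Prop :=
  DifferentiableAt ℝ F q ∧
    ∀ v₁ v₂ : Fin 3 → ℝ, dot q.1 v₁ = 0 → dot q.2 v₂ = 0 → fderiv ℝ F q (v₁, v₂) = 0

theorem iota_eq (q : (Fin 3 → ℝ) × (Fin 3 → ℝ)) :
    iota q = ![q.1 2, q.2 2, q.1 0 * q.2 0 + q.1 1 * q.2 1] := by
  simp [iota, dot, e3, P3, Fin.sum_univ_three]

theorem exists_hasFDerivAt_iota (q : (Fin 3 → ℝ) × (Fin 3 → ℝ)) :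
    ∃ L : (Fin 3 → ℝ) × (Fin 3 → ℝ) →L[ℝ] (Fin 3 → ℝ), HasFDerivAt iota L q ∧
      ∀ v, L v = ![v.1 2, v.2 2,
        q.1 0 * v.2 0 + q.2 0 * v.1 0 + (q.1 1 * v.2 1 + q.2 1 * v.1 1)] := by
  let x (i : Fin 3) : (Fin 3 → ℝ) × (Fin 3 → ℝ) →L[ℝ] ℝ :=
    (ContinuousLinearMap.proj i).comp (ContinuousLinearMap.fst ℝ _ _)
  let y (i : Fin 3) : (Fin 3 → ℝ) × (Fin 3 → ℝ) →L[ℝ] ℝ :=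
    (ContinuousLinearMap.proj i).comp (ContinuousLinearMap.snd ℝ _ _)
  have hx (i : Fin 3) : HasFDerivAt (fun p => x i p) (x i) q := (x i).hasFDerivAt
  have hy (i : Fin 3) : HasFDerivAt (fun p => y i p) (y i) q := (y i).hasFDerivAt
  refine ⟨ContinuousLinearMap.pi ![x 2, y 2,
    (x 0 q • y 0 + y 0 q • x 0) + (x 1 q • y 1 + y 1 q • x 1)], ?_, fun v => ?_⟩
  · rw [show iota = _ from funext iota_eq, hasFDerivAt_pi]
    intro i
    fin_cases i
    · exact hx 2
    · exact hy 2
    · exact ((hx 0).mul (hy 0)).add ((hx 1).mul (hy 1))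
  · ext i
    fin_cases i <;> simp [x, y]

theorem horizontal_det_ne_zero {q₁ q₂ : Fin 3 → ℝ}
    (h : LinearIndependent ℝ ![q₁, q₂, e3]) : q₁ 0 * q₂ 1 - q₁ 1 * q₂ 0 ≠ 0 := by
  have hdet : IsUnit (Matrix.of ![q₁, q₂, e3]) :=
    Matrix.linearIndependent_rows_iff_isUnit.mp h
  rw [Matrix.isUnit_iff_isUnit_det, isUnit_iff_ne_zero, Matrix.det_fin_three] at hdet
  simpa [e3] using hdet

/-- When `{q₁, q₂, e₃}` is linearly independent, `(q₁,q₂)` is a critical point of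
`f ∘ ι` on `S² × S²` iff `ι(q₁,q₂)` is a critical point of `f`. -/
theorem stmt4 (q₁ q₂ : Fin 3 → ℝ) (h₁ : dot q₁ q₁ = 1) (h₂ : dot q₂ q₂ = 1)
    (hind : LinearIndependent ℝ ![q₁, q₂, e3])
    (f : (Fin 3 → ℝ) → ℝ) (hf : DifferentiableAt ℝ f (iota (q₁, q₂))) :
    IsCritPt (fun q => f (iota q)) (q₁, q₂) ↔ fderiv ℝ f (iota (q₁, q₂)) = 0 := by
  obtain ⟨L, hL, hLv⟩ := exists_hasFDerivAt_iota (q₁, q₂)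
  have hcomp : HasFDerivAt (fun q => f (iota q)) ((fderiv ℝ f (iota (q₁, q₂))).comp L) (q₁, q₂) :=
    hf.hasFDerivAt.comp _ hL
  refine ⟨fun ⟨_, hcrit⟩ => ?_, fun h => ⟨hcomp.differentiableAt, fun v₁ v₂ _ _ => ?_⟩⟩
  · have hD := horizontal_det_ne_zero hind
    set D := q₁ 0 * q₂ 1 - q₁ 1 * q₂ 0 with hDdef
    ext w
    -- Tangent vectors `v₁`, `v₂` that the differential of `iota` maps to `w`.
    let v₁ : Fin 3 → ℝ := ![(-(q₁ 2 * w 0 * q₂ 1) - q₁ 1 * w 2) / D,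
      (q₁ 0 * w 2 + q₂ 0 * q₁ 2 * w 0) / D, w 0]
    let v₂ : Fin 3 → ℝ := ![q₁ 1 * q₂ 2 * w 1 / D, -(q₁ 0 * q₂ 2 * w 1) / D, w 1]
    have ht₁ : dot q₁ v₁ = 0 := by
      simp only [dot, Fin.sum_univ_three, v₁, Matrix.cons_val]
      field_simp
      rw [hDdef]; ring
    have ht₂ : dot q₂ v₂ = 0 := by
      simp only [dot, Fin.sum_univ_three, v₂, Matrix.cons_val]
      field_simp
      rw [hDdef]; ring
    have hw : L (v₁, v₂) = w := by
      rw [hLv]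
      ext i
      fin_cases i
      · rfl
      · rfl
      · simp only [v₁, v₂, Matrix.cons_val, Fin.reduceFinMk]
        field_simp
        rw [hDdef]; ring
    have hzero := hcrit v₁ v₂ ht₁ ht₂
    rw [hcomp.fderiv, ContinuousLinearMap.comp_apply, hw] at hzero
    simpa using hzero
  · rw [hcomp.fderiv, h]
    simp
end
end

section
/- Let q₁, q₂ ∈ ℝ³ with q₁ ∈ {e₃, −e₃} and q₂ ∈ {e₃, −e₃} (both pendula vertical). Then for all v₁, v₂ ∈ ℝ³ with ⟨q₁,v₁⟩ = ⟨q₂,v₂⟩ = 0, one has (fderiv ι (q₁,q₂))(v₁,v₂) = 0; consequently (q₁,q₂) is a critical point of f ∘ ι restricted to S² × S² for every function f : ℝ³ → ℝ differentiable at ι(q₁,q₂). -/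
noncomputable section

theorem differentiable_iota : Differentiable ℝ iota := by
  rw [differentiable_pi]
  intro i
  fin_cases i <;> simp only [iota, dot, P3, e3, Fin.sum_univ_three] <;> simp <;> fun_prop

/-- The differential of `iota`, computed by differentiating along lines. -/
theorem fderiv_iota (q v : (Fin 3 → ℝ) × (Fin 3 → ℝ)) :
    fderiv ℝ iota q v =
      ![dot e3 v.1, dot e3 v.2, dot v.1 (P3 q.2) + dot q.1 (P3 v.2)] := by
  rw [← (differentiable_iota q).lineDeriv_eq_fderiv]
  refine HasLineDerivAt.lineDeriv ?_
  have expand : ∀ t : ℝ, iota (q + t • v) = iota q +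
      t • ![dot e3 v.1, dot e3 v.2, dot v.1 (P3 q.2) + dot q.1 (P3 v.2)] +
      t ^ 2 • ![0, 0, dot v.1 (P3 v.2)] := by
    intro t
    ext i
    fin_cases i <;> simp [iota, dot, P3, e3, Fin.sum_univ_three]
    ring
  rw [HasLineDerivAt, funext expand]
  generalize ![dot e3 v.1, dot e3 v.2, dot v.1 (P3 q.2) + dot q.1 (P3 v.2)] = a
  generalize ![0, 0, dot v.1 (P3 v.2)] = b
  simpa using (((hasDerivAt_id' (0 : ℝ)).smul_const a).const_add (iota q)).fun_add
    ((hasDerivAt_pow 2 (0 : ℝ)).smul_const b)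

/-- Horizontal projection annihilates vertical vectors. -/
theorem P3_e3 : P3 e3 = 0 := by
  ext i
  fin_cases i <;> simp [P3, dot, e3, Fin.sum_univ_three]

theorem P3_neg (v : Fin 3 → ℝ) : P3 (-v) = -P3 v := by
  ext i
  simp [P3, dot]
  ring

theorem dot_e3_P3 (v : Fin 3 → ℝ) : dot e3 (P3 v) = 0 := by
  simp [P3, dot, e3, Fin.sum_univ_three]

theorem dot_neg_left (x y : Fin 3 → ℝ) : dot (-x) y = -dot x y := by
  simp [dot]

theorem dot_zero_right (x : Fin 3 → ℝ) : dot x 0 = 0 := by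
  simp [dot]

/-- At vertical configurations the differential of `iota` annihilates all tangent vectors. -/
theorem fderiv_iota_eq_zero {q₁ q₂ : Fin 3 → ℝ}
    (h₁ : q₁ = e3 ∨ q₁ = -e3) (h₂ : q₂ = e3 ∨ q₂ = -e3) (v₁ v₂ : Fin 3 → ℝ)
    (hv₁ : dot q₁ v₁ = 0) (hv₂ : dot q₂ v₂ = 0) :
    fderiv ℝ iota (q₁, q₂) (v₁, v₂) = 0 := by
  rw [fderiv_iota]
  rcases h₁ with rfl | rfl <;> rcases h₂ with rfl | rfl <;>
    simp_all [dot_neg_left, P3_neg, P3_e3, dot_e3_P3, dot_zero_right]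

/-- If both pendula are vertical, the differential of `ι` vanishes on all tangent
vectors to `S² × S²`; consequently `(q₁,q₂)` is a critical point of `f ∘ ι`
restricted to `S² × S²` for every `f` differentiable at `ι(q₁,q₂)`. -/
theorem stmt5 (q₁ q₂ : Fin 3 → ℝ)
    (h₁ : q₁ = e3 ∨ q₁ = -e3) (h₂ : q₂ = e3 ∨ q₂ = -e3) :
    (∀ v₁ v₂ : Fin 3 → ℝ, dot q₁ v₁ = 0 → dot q₂ v₂ = 0 →
        fderiv ℝ iota (q₁, q₂) (v₁, v₂) = 0) ∧
      ∀ f : (Fin 3 → ℝ) → ℝ, DifferentiableAt ℝ f (iota (q₁, q₂)) →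
        IsCritPt (fun q => f (iota q)) (q₁, q₂) := by
  refine ⟨fderiv_iota_eq_zero h₁ h₂, fun f hf => ?_⟩
  have hι := differentiable_iota (q₁, q₂)
  refine ⟨hf.comp _ hι, fun v₁ v₂ hv₁ hv₂ => ?_⟩
  have chain := fderiv_comp (q₁, q₂) hf hι
  rw [Function.comp_def] at chain
  rw [chain, ContinuousLinearMap.comp_apply, fderiv_iota_eq_zero h₁ h₂ v₁ v₂ hv₁ hv₂, map_zero]
end
end

section
/- Let q₁, q₂ ∈ ℝ³ with ‖q₁‖ = ‖q₂‖ = 1, q₁ ∉ {e₃,−e₃}, q₂ ∉ {e₃,−e₃}, and ⟨e₃, q₁ × q₂⟩ = 0 (so {q₁,q₂,e₃} spans a plane), and let f : ℝ³ → ℝ be differentiable at ι = ι(q₁,q₂) with partial derivatives ∂ⱼf(ι) = (fderiv f ι)(eⱼ). Then (q₁,q₂) is a critical point of f ∘ ι restricted to S² × S² if and only if (1 − ι₁²)·∂₁f(ι) = ι₁·ι₃·∂₃f(ι) and (1 − ι₂²)·∂₂f(ι) = ι₂·ι₃·∂₃f(ι), where (ι₁,ι₂,ι₃) are the components of ι(q₁,q₂).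 -/
noncomputable section

theorem dot_eq (x y : Fin 3 → ℝ) : dot x y = x 0 * y 0 + x 1 * y 1 + x 2 * y 2 := by
  simp [dot, Fin.sum_univ_three]

theorem eq_e3_or_eq_neg_e3 {q : Fin 3 → ℝ} (h : dot q q = 1) (hz : 1 - q 2 ^ 2 = 0) :
    q = e3 ∨ q = -e3 := by
  rw [dot_eq] at h
  have h0 : q 0 = 0 := by nlinarith [sq_nonneg (q 0), sq_nonneg (q 1)]
  have h1 : q 1 = 0 := by nlinarith [sq_nonneg (q 0), sq_nonneg (q 1)]
  have h2 : q 2 = 1 ∨ q 2 = -1 := by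
    simpa using (sq_eq_sq_iff_eq_or_eq_neg (a := q 2) (b := 1)).mp (by linarith)
  refine h2.imp (fun h2 => ?_) (fun h2 => ?_) <;>
  · ext i
    fin_cases i <;> simp [e3, h0, h1, h2]

theorem hasFDerivAt_iota (q : (Fin 3 → ℝ) × (Fin 3 → ℝ)) :
    ∃ L : ((Fin 3 → ℝ) × (Fin 3 → ℝ)) →L[ℝ] (Fin 3 → ℝ), HasFDerivAt iota L q ∧
      ∀ v, L v = ![v.1 2, v.2 2,
        (v.1 0 * q.2 0 + v.1 1 * q.2 1) + (v.2 0 * q.1 0 + v.2 1 * q.1 1)] := by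
  let X (i : Fin 3) : ((Fin 3 → ℝ) × (Fin 3 → ℝ)) →L[ℝ] ℝ :=
    (ContinuousLinearMap.proj i).comp (ContinuousLinearMap.fst ℝ _ _)
  let Y (i : Fin 3) : ((Fin 3 → ℝ) × (Fin 3 → ℝ)) →L[ℝ] ℝ :=
    (ContinuousLinearMap.proj i).comp (ContinuousLinearMap.snd ℝ _ _)
  have hX (i : Fin 3) : HasFDerivAt (fun p : (Fin 3 → ℝ) × (Fin 3 → ℝ) => p.1 i) (X i) q :=
    (X i).hasFDerivAt
  have hY (i : Fin 3) : HasFDerivAt (fun p : (Fin 3 → ℝ) × (Fin 3 → ℝ) => p.2 i) (Y i) q :=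
    (Y i).hasFDerivAt
  refine ⟨ContinuousLinearMap.pi ![X 2, Y 2,
    (q.1 0 • Y 0 + q.2 0 • X 0) + (q.1 1 • Y 1 + q.2 1 • X 1)], ?_, fun v => ?_⟩
  · rw [funext iota_eq, hasFDerivAt_pi]
    intro i
    fin_cases i
    · exact hX 2
    · exact hY 2
    · exact ((hX 0).mul (hY 0)).add ((hX 1).mul (hY 1))
  · ext i
    fin_cases i <;> simp [X, Y]
    ring

theorem fin_three_clm_apply (D : (Fin 3 → ℝ) →L[ℝ] ℝ) (v : Fin 3 → ℝ) :
    D v = v 0 * D (Pi.single 0 1) + v 1 * D (Pi.single 1 1) + v 2 * D (Pi.single 2 1) := by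
  have hv : v = v 0 • Pi.single 0 1 + v 1 • Pi.single 1 1 + v 2 • Pi.single 2 1 := by
    ext i
    fin_cases i <;> simp
  conv_lhs => rw [hv]
  simp only [map_add, map_smul, smul_eq_mul]

/-- If the horizontal parts of `q` and `p` are parallel and `q` is a non-vertical unit vector, the
functional `v ↦ a v₃ + c ⟨v, P₃ p⟩` vanishes on the tangent plane at `q` iff one scalar equation
holds. -/
theorem forall_tangent_eq_zero_iff {q p : Fin 3 → ℝ} (h : dot q q = 1) (hv : q ≠ e3 ∧ q ≠ -e3)
    (hpar : q 0 * p 1 = q 1 * p 0) (a c : ℝ) :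
    (∀ v, dot q v = 0 → v 2 * a + (v 0 * p 0 + v 1 * p 1) * c = 0) ↔
      (1 - q 2 ^ 2) * a = q 2 * (q 0 * p 0 + q 1 * p 1) * c := by
  have hr : 1 - q 2 ^ 2 ≠ 0 := fun hz => (eq_e3_or_eq_neg_e3 h hz).elim hv.1 hv.2
  rw [dot_eq] at h
  constructor
  · intro H
    have := H ![-q 2 * q 0, -q 2 * q 1, 1 - q 2 ^ 2] (by
      simp [dot_eq]; linear_combination (-q 2) * h)
    simp at this
    linear_combination this
  · intro H v hvq
    rw [dot_eq] at hvq
    refine (mul_eq_zero.mp ?_).resolve_left hr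
    have h0 : (1 - q 2 ^ 2) * p 0 = (q 0 * p 0 + q 1 * p 1) * q 0 := by
      linear_combination -p 0 * h - q 1 * hpar
    have h1 : (1 - q 2 ^ 2) * p 1 = (q 0 * p 0 + q 1 * p 1) * q 1 := by
      linear_combination -p 1 * h + q 0 * hpar
    linear_combination v 2 * H + v 0 * c * h0 + v 1 * c * h1
      + (q 0 * p 0 + q 1 * p 1) * c * hvq

/-- If neither pendulum is vertical but `{q₁,q₂,e₃}` spans a plane, `(q₁,q₂)` is a
critical point of `f ∘ ι` on `S² × S²` iff `(1 - ιⱼ²)∂ⱼf = ιⱼ ι₃ ∂₃f` for `j = 1, 2`. -/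
theorem stmt6 (q₁ q₂ : Fin 3 → ℝ) (h₁ : dot q₁ q₁ = 1) (h₂ : dot q₂ q₂ = 1)
    (hv₁ : q₁ ≠ e3 ∧ q₁ ≠ -e3) (hv₂ : q₂ ≠ e3 ∧ q₂ ≠ -e3)
    (hplane : dot e3 (crossProduct q₁ q₂) = 0)
    (f : (Fin 3 → ℝ) → ℝ) (hf : DifferentiableAt ℝ f (iota (q₁, q₂))) :
    IsCritPt (fun q => f (iota q)) (q₁, q₂) ↔
      ((1 - iota (q₁, q₂) 0 ^ 2) * fderiv ℝ f (iota (q₁, q₂)) (Pi.single 0 1)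
          = iota (q₁, q₂) 0 * iota (q₁, q₂) 2 * fderiv ℝ f (iota (q₁, q₂)) (Pi.single 2 1)
        ∧ (1 - iota (q₁, q₂) 1 ^ 2) * fderiv ℝ f (iota (q₁, q₂)) (Pi.single 1 1)
          = iota (q₁, q₂) 1 * iota (q₁, q₂) 2 * fderiv ℝ f (iota (q₁, q₂)) (Pi.single 2 1)) := by
  have hpar : q₁ 0 * q₂ 1 = q₁ 1 * q₂ 0 := by
    simp [dot_eq, e3, cross_apply] at hplane
    linarith
  obtain ⟨L, hL, hLv⟩ := hasFDerivAt_iota (q₁, q₂)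
  have hcomp : HasFDerivAt (fun q => f (iota q)) _ (q₁, q₂) := hf.hasFDerivAt.comp (q₁, q₂) hL
  set D := fderiv ℝ f (iota (q₁, q₂))
  have hD (v₁ v₂ : Fin 3 → ℝ) : fderiv ℝ (fun q => f (iota q)) (q₁, q₂) (v₁, v₂) =
      (v₁ 2 * D (Pi.single 0 1) + (v₁ 0 * q₂ 0 + v₁ 1 * q₂ 1) * D (Pi.single 2 1)) +
      (v₂ 2 * D (Pi.single 1 1) + (v₂ 0 * q₁ 0 + v₂ 1 * q₁ 1) * D (Pi.single 2 1)) := by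
    rw [hcomp.fderiv, ContinuousLinearMap.comp_apply, hLv, fin_three_clm_apply]
    simp
    ring
  have i0 : iota (q₁, q₂) 0 = q₁ 2 := by simp [iota_eq]
  have i1 : iota (q₁, q₂) 1 = q₂ 2 := by simp [iota_eq]
  have i2 : iota (q₁, q₂) 2 = q₁ 0 * q₂ 0 + q₁ 1 * q₂ 1 := by simp [iota_eq]
  have i2' : q₁ 0 * q₂ 0 + q₁ 1 * q₂ 1 = q₂ 0 * q₁ 0 + q₂ 1 * q₁ 1 := by ring
  rw [i0, i1, i2, ← forall_tangent_eq_zero_iff h₁ hv₁ hpar, i2',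
    ← forall_tangent_eq_zero_iff h₂ hv₂ (by linarith)]
  constructor
  · rintro ⟨-, H⟩
    refine ⟨fun v hv => ?_, fun v hv => ?_⟩
    · simpa [hD] using H v 0 hv (by simp [dot_eq])
    · simpa [hD] using H 0 v (by simp [dot_eq]) hv
  · rintro ⟨H₁, H₂⟩
    refine ⟨hcomp.differentiableAt, fun v₁ v₂ hv₁ hv₂ => ?_⟩
    rw [hD, H₁ v₁ hv₁, H₂ v₂ hv₂, add_zero]
end
end

section
/- Let q₁, q₂ ∈ ℝ³ with ‖q₁‖ = ‖q₂‖ = 1 and ⟨e₃, q₁ × q₂⟩ = 0 (i.e. {q₁, q₂, e₃} is linearly dependent). Then the components (ι₁, ι₂, ι₃) of ι(q₁,q₂) satisfy ι₃² = (1 − ι₁²)·(1 − ι₂²). -/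
noncomputable section

/-- If `{q₁, q₂, e₃}` is linearly dependent, the components of `ι(q₁,q₂)` satisfy
`ι₃² = (1 - ι₁²)(1 - ι₂²)`. -/
theorem stmt8 (q₁ q₂ : Fin 3 → ℝ) (h₁ : dot q₁ q₁ = 1) (h₂ : dot q₂ q₂ = 1)
    (hdep : dot e3 (crossProduct q₁ q₂) = 0) :
    iota (q₁, q₂) 2 ^ 2 = (1 - iota (q₁, q₂) 0 ^ 2) * (1 - iota (q₁, q₂) 1 ^ 2) := by
  simp [dot, e3, crossProduct, Fin.sum_univ_three] at h₁ h₂ hdep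
  simp [iota, P3, dot, e3, Fin.sum_univ_three]
  have hx : 1 - q₁ 2 ^ 2 = q₁ 0 ^ 2 + q₁ 1 ^ 2 := by linear_combination -h₁
  have hy : 1 - q₂ 2 ^ 2 = q₂ 0 ^ 2 + q₂ 1 ^ 2 := by linear_combination -h₂
  rw [hx, hy]
  linear_combination -(q₁ 0 * q₂ 1 - q₁ 1 * q₂ 0) * hdep
end
end

section
/- Let m₁, m₂, ℓ₁, ℓ₂ > 0, g ≠ 0, ξ ∈ ℝ, and define the locked Lagrangian L_ξ : ℝ³ × ℝ³ → ℝ by L_ξ(q₁,q₂) = (ξ²/2)·(m₁·ℓ₁²·‖e₃ × q₁‖² + m₂·‖e₃ × (ℓ₁·q₁ + ℓ₂·q₂)‖²) − g·⟨e₃, (m₁ + m₂)·ℓ₁·q₁ + m₂·ℓ₂·q₂⟩. If (q₁,q₂) with ‖q₁‖ = ‖q₂‖ = 1 is a critical point of L_ξ restricted to S² × S², then ⟨e₃, q₁ × q₂⟩ = 0, and q₁ ∈ {e₃, −e₃} holds if and only if q₂ ∈ {e₃, −e₃} (either both or neither pendulum is vertical). -/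
noncomputable section

/-- The locked Lagrangian of the double spherical pendulum. -/
def Lxi (m₁ m₂ l₁ l₂ g ξ : ℝ) (q : (Fin 3 → ℝ) × (Fin 3 → ℝ)) : ℝ :=
  ξ ^ 2 / 2 *
      (m₁ * l₁ ^ 2 * dot (crossProduct e3 q.1) (crossProduct e3 q.1)
        + m₂ * dot (crossProduct e3 (l₁ • q.1 + l₂ • q.2))
            (crossProduct e3 (l₁ • q.1 + l₂ • q.2)))
    - g * dot e3 (((m₁ + m₂) * l₁) • q.1 + (m₂ * l₂) • q.2)

/-- The locked Lagrangian in coordinates. -/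
lemma Lxi_apply (m₁ m₂ l₁ l₂ g ξ : ℝ) (p r : Fin 3 → ℝ) :
    Lxi m₁ m₂ l₁ l₂ g ξ (p, r) =
      ξ ^ 2 / 2 * (m₁ * l₁ ^ 2 * (p 0 ^ 2 + p 1 ^ 2)
        + m₂ * ((l₁ * p 0 + l₂ * r 0) ^ 2 + (l₁ * p 1 + l₂ * r 1) ^ 2))
      - g * ((m₁ + m₂) * l₁ * p 2 + m₂ * l₂ * r 2) := by
  simp [Lxi, dot, e3, crossProduct, Fin.sum_univ_three, -mul_eq_mul_left_iff]
  ring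

/-- The explicit directional derivative of the locked Lagrangian vanishes where its differential
vanishes. -/
lemma Lxi_directional_deriv_eq_zero {m₁ m₂ l₁ l₂ g ξ : ℝ} {p r : Fin 3 → ℝ}
    (hd : DifferentiableAt ℝ (Lxi m₁ m₂ l₁ l₂ g ξ) (p, r)) {v w : Fin 3 → ℝ}
    (h : fderiv ℝ (Lxi m₁ m₂ l₁ l₂ g ξ) (p, r) (v, w) = 0) :
    ξ ^ 2 * (m₁ * l₁ ^ 2 * (p 0 * v 0 + p 1 * v 1)
        + m₂ * ((l₁ * p 0 + l₂ * r 0) * (l₁ * v 0 + l₂ * w 0)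
          + (l₁ * p 1 + l₂ * r 1) * (l₁ * v 1 + l₂ * w 1)))
      - g * ((m₁ + m₂) * l₁ * v 2 + m₂ * l₂ * w 2) = 0 := by
  have hline := hd.hasFDerivAt.hasLineDerivAt (v, w)
  rw [h, HasLineDerivAt] at hline
  set c := ξ ^ 2 * (m₁ * l₁ ^ 2 * (p 0 * v 0 + p 1 * v 1)
        + m₂ * ((l₁ * p 0 + l₂ * r 0) * (l₁ * v 0 + l₂ * w 0)
          + (l₁ * p 1 + l₂ * r 1) * (l₁ * v 1 + l₂ * w 1)))
      - g * ((m₁ + m₂) * l₁ * v 2 + m₂ * l₂ * w 2) with hc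
  let d := ξ ^ 2 / 2 * (m₁ * l₁ ^ 2 * (v 0 ^ 2 + v 1 ^ 2)
        + m₂ * ((l₁ * v 0 + l₂ * w 0) ^ 2 + (l₁ * v 1 + l₂ * w 1) ^ 2))
  have hpoly : (fun t : ℝ => Lxi m₁ m₂ l₁ l₂ g ξ ((p, r) + t • (v, w))) =
      fun t => Lxi m₁ m₂ l₁ l₂ g ξ (p, r) + t * c + t ^ 2 * d := by
    funext t
    rw [Prod.smul_mk, Prod.mk_add_mk, Lxi_apply, Lxi_apply]
    simp only [Pi.add_apply, Pi.smul_apply, smul_eq_mul, hc, d]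
    ring
  rw [hpoly] at hline
  have hderiv : HasDerivAt
      (fun t : ℝ => Lxi m₁ m₂ l₁ l₂ g ξ (p, r) + t * c + t ^ 2 * d) c 0 := by
    refine ((((hasDerivAt_id (0 : ℝ)).mul_const c).const_add
      (Lxi m₁ m₂ l₁ l₂ g ξ (p, r))).add
        ((hasDerivAt_pow 2 (0 : ℝ)).mul_const d)).congr_deriv ?_
    simp
  exact hderiv.unique hline

/-- A unit vector is vertical iff its horizontal coordinates vanish. -/
lemma eq_e3_or_eq_neg_e3_iff {q : Fin 3 → ℝ} (h : dot q q = 1) :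
    (q = e3 ∨ q = -e3) ↔ q 0 = 0 ∧ q 1 = 0 := by
  constructor
  · rintro (rfl | rfl) <;> simp [e3]
  · rintro ⟨h0, h1⟩
    have h2 : q 2 * q 2 = 1 := by simpa [dot, Fin.sum_univ_three, h0, h1] using h
    rcases mul_self_eq_one_iff.mp h2 with h2 | h2
    · left; ext i; fin_cases i <;> simp [e3, h0, h1, h2]
    · right; ext i; fin_cases i <;> simp [e3, h0, h1, h2]

/-- At a critical point of the locked Lagrangian of the double spherical pendulum,
`q₁, q₂, e₃` are coplanar and either both or neither pendulum is vertical. -/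
theorem stmt10 (m₁ m₂ l₁ l₂ g ξ : ℝ) (hm₁ : 0 < m₁) (hm₂ : 0 < m₂)
    (hl₁ : 0 < l₁) (hl₂ : 0 < l₂) (hg : g ≠ 0)
    (q₁ q₂ : Fin 3 → ℝ) (h₁ : dot q₁ q₁ = 1) (h₂ : dot q₂ q₂ = 1)
    (hcrit : IsCritPt (Lxi m₁ m₂ l₁ l₂ g ξ) (q₁, q₂)) :
    dot e3 (crossProduct q₁ q₂) = 0 ∧
      ((q₁ = e3 ∨ q₁ = -e3) ↔ (q₂ = e3 ∨ q₂ = -e3)) := by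
  obtain ⟨hd, hc⟩ := hcrit
  have hfst (v : Fin 3 → ℝ) (hv : dot q₁ v = 0) :=
    Lxi_directional_deriv_eq_zero hd (hc v 0 hv (by simp [dot]))
  have hsnd (v : Fin 3 → ℝ) (hv : dot q₂ v = 0) :=
    Lxi_directional_deriv_eq_zero hd (hc 0 v (by simp [dot]) hv)
  have tangent₁ (q : Fin 3 → ℝ) : dot q ![q 1, -q 0, 0] = 0 := by
    simp [dot, Fin.sum_univ_three]; ring
  have tangent₂ (q : Fin 3 → ℝ) : dot q ![q 2, 0, -q 0] = 0 := by
    simp [dot, Fin.sum_univ_three]; ring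
  have tangent₃ (q : Fin 3 → ℝ) : dot q ![0, q 2, -q 1] = 0 := by
    simp [dot, Fin.sum_univ_three]; ring
  have a₂ := hfst _ (tangent₂ q₁)
  have a₃ := hfst _ (tangent₃ q₁)
  have b₁ := hsnd _ (tangent₁ q₂)
  have b₂ := hsnd _ (tangent₂ q₂)
  have b₃ := hsnd _ (tangent₃ q₂)
  rw [eq_e3_or_eq_neg_e3_iff h₁, eq_e3_or_eq_neg_e3_iff h₂]
  simp only [Matrix.cons_val_zero, Matrix.cons_val_one, Matrix.cons_val, Pi.zero_apply]
    at a₂ a₃ b₁ b₂ b₃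
  have hcross : dot e3 (crossProduct q₁ q₂) = q₁ 0 * q₂ 1 - q₁ 1 * q₂ 0 := by
    simp [dot, e3, crossProduct, Fin.sum_univ_three]
  simp only [dot, Fin.sum_univ_three] at h₁ h₂
  rw [hcross]
  have hl : m₂ * l₁ * l₂ ≠ 0 := by positivity
  rcases eq_or_ne ξ 0 with rfl | hξ
  · have hM : g * ((m₁ + m₂) * l₁) ≠ 0 := mul_ne_zero hg (by positivity)
    have hm : g * (m₂ * l₂) ≠ 0 := mul_ne_zero hg (by positivity)
    have x₁ : q₁ 0 = 0 := mul_left_cancel₀ hM (by linear_combination a₂)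
    have y₁ : q₁ 1 = 0 := mul_left_cancel₀ hM (by linear_combination a₃)
    have x₂ : q₂ 0 = 0 := mul_left_cancel₀ hm (by linear_combination b₂)
    have y₂ : q₂ 1 = 0 := mul_left_cancel₀ hm (by linear_combination b₃)
    simp [x₁, y₁, x₂, y₂]
  · have hK : ξ ^ 2 * (m₂ * l₁ * l₂) ≠ 0 := mul_ne_zero (pow_ne_zero 2 hξ) hl
    refine ⟨mul_left_cancel₀ hK (by linear_combination b₁), ?_, ?_⟩
    · rintro ⟨x, y⟩
      simp only [x, y] at a₂ a₃ h₁
      have z : q₁ 2 ≠ 0 := by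
        intro z
        simp [z] at h₁
      have hKz := mul_ne_zero hK z
      exact ⟨mul_left_cancel₀ hKz (by linear_combination a₂),
        mul_left_cancel₀ hKz (by linear_combination a₃)⟩
    · rintro ⟨x, y⟩
      simp only [x, y] at b₂ b₃ h₂
      have z : q₂ 2 ≠ 0 := by
        intro z
        simp [z] at h₂
      have hKz := mul_ne_zero hK z
      exact ⟨mul_left_cancel₀ hKz (by linear_combination b₂),
        mul_left_cancel₀ hKz (by linear_combination b₃)⟩
end
end

section
/- Define C(A, η, ζ) = ⟨η × (A·Aᵀ·η), A·ζ⟩ + ⟨ζ × (Aᵀ·A·ζ), Aᵀ·η⟩ for a real 3×3 matrix A and η, ζ ∈ ℝ³. If det A = 1, then C(A, η, ζ) + C((A⁻¹)ᵀ, η, ζ) = 0. -/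
open Matrix

/-- The invariant `C(A,η,ζ) = ⟨η × (AAᵀη), Aζ⟩ + ⟨ζ × (AᵀAζ), Aᵀη⟩`. -/
def Cfun (A : Matrix (Fin 3) (Fin 3) ℝ) (η ζ : Fin 3 → ℝ) : ℝ :=
  dot (crossProduct η ((A * Aᵀ).mulVec η)) (A.mulVec ζ)
    + dot (crossProduct ζ ((Aᵀ * A).mulVec ζ)) (Aᵀ.mulVec η)

theorem dot_cross_mulVec (M : Matrix (Fin 3) (Fin 3) ℝ) (u v w : Fin 3 → ℝ) :
    dot (crossProduct (M.mulVec u) (M.mulVec v)) (M.mulVec w)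
      = M.det * dot (crossProduct u v) w := by
  simp only [dot, cross_apply, mulVec, dotProduct, Fin.sum_univ_three, det_fin_three, cons_val]
  ring

/-- Each summand of `Cfun` is itself anti-symmetric under `A ↦ (A⁻¹)ᵀ`: both values are, up to
sign, the triple product of `A⁻¹η`, `Aᵀη` and `ζ`. -/
theorem dot_cross_add_dot_cross_inv_transpose (A B : Matrix (Fin 3) (Fin 3) ℝ) (hA : A.det = 1)
    (hB : B.det = 1) (hAB : A * Bᵀ = 1) (hBA : B * Aᵀ = 1) (η ζ : Fin 3 → ℝ) :
    dot (crossProduct η ((A * Aᵀ).mulVec η)) (A.mulVec ζ)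
      + dot (crossProduct η ((B * Bᵀ).mulVec η)) (B.mulVec ζ) = 0 := by
  have key (M N : Matrix (Fin 3) (Fin 3) ℝ) (hM : M.det = 1) (hMN : M * Nᵀ = 1) :
      dot (crossProduct η ((M * Mᵀ).mulVec η)) (M.mulVec ζ)
        = dot (crossProduct (Nᵀ.mulVec η) (Mᵀ.mulVec η)) ζ := by
    have h := dot_cross_mulVec M (Nᵀ.mulVec η) (Mᵀ.mulVec η) ζ
    rwa [mulVec_mulVec, mulVec_mulVec, hMN, one_mulVec, hM, one_mul] at h
  rw [key A B hA hAB, key B A hB hBA, ← cross_anticomm (Aᵀ.mulVec η)]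
  simp [dot]

/-- Anti-symmetry of `C` under `A ↦ (A⁻¹)ᵀ` for `A ∈ SL(3,ℝ)`. -/
theorem stmt15 (A : Matrix (Fin 3) (Fin 3) ℝ) (h : A.det = 1) (η ζ : Fin 3 → ℝ) :
    Cfun A η ζ + Cfun (A⁻¹)ᵀ η ζ = 0 := by
  have hu : IsUnit A.det := by simp [h]
  have hr : A * A⁻¹ = 1 := mul_nonsing_inv A hu
  have hl : A⁻¹ * A = 1 := nonsing_inv_mul A hu
  have hl' : (A⁻¹)ᵀ * Aᵀ = 1 := by rw [← transpose_mul, hr, transpose_one]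
  have hr' : Aᵀ * (A⁻¹)ᵀ = 1 := by rw [← transpose_mul, hl, transpose_one]
  have hd : (A⁻¹).det = 1 := by simp [det_nonsing_inv, h]
  have h₁ := dot_cross_add_dot_cross_inv_transpose A (A⁻¹)ᵀ h (by rwa [det_transpose])
    (by rwa [transpose_transpose]) hl' η ζ
  have h₂ := dot_cross_add_dot_cross_inv_transpose Aᵀ A⁻¹ (by rwa [det_transpose]) hd
    hr' (by rwa [transpose_transpose]) ζ η
  simp only [transpose_transpose] at h₁ h₂
  simp only [Cfun, transpose_transpose]
  linarith
end

section
/- Define C(A, η, ζ) = ⟨η × (A·Aᵀ·η), A·ζ⟩ + ⟨ζ × (Aᵀ·A·ζ), Aᵀ·η⟩ for a real 3×3 matrix A and η, ζ ∈ ℝ³. Then for all U, V ∈ SO(3): C(U·A·Vᵀ, U·η, V·ζ) = C(A, η, ζ); moreover C(Aᵀ, ζ, η) = C(A, η, ζ) and C(A, −η, −ζ) = −C(A, η, ζ). -/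
open Matrix

/-- The triple product is scaled by the determinant under a linear map. -/
theorem dot_crossProduct_mulVec (U : Matrix (Fin 3) (Fin 3) ℝ) (x y z : Fin 3 → ℝ) :
    dot (crossProduct (U *ᵥ x) (U *ᵥ y)) (U *ᵥ z) = U.det * dot (crossProduct x y) z := by
  simp only [dot, cross_apply, mulVec, dotProduct, det_fin_three, Fin.sum_univ_three,
    cons_val_zero, cons_val_one, cons_val]
  ring

theorem dot_neg_right (x y : Fin 3 → ℝ) : dot x (-y) = -dot x y := by
  simp [dot]

/-- Invariance of `C` under the action of `ℤ₂ ⋉ (SO(3) × SO(3))` and equivariance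
under negation of the algebra element. -/
theorem stmt16 (A : Matrix (Fin 3) (Fin 3) ℝ) (η ζ : Fin 3 → ℝ) :
    (∀ U V : Matrix (Fin 3) (Fin 3) ℝ,
        Uᵀ * U = 1 → U.det = 1 → Vᵀ * V = 1 → V.det = 1 →
        Cfun (U * A * Vᵀ) (U.mulVec η) (V.mulVec ζ) = Cfun A η ζ)
      ∧ Cfun Aᵀ ζ η = Cfun A η ζ
      ∧ Cfun A (-η) (-ζ) = -Cfun A η ζ := by
  refine ⟨fun U V hU hUdet hV hVdet => ?_, ?_, ?_⟩
  · have hη : (U * A * Vᵀ * (U * A * Vᵀ)ᵀ) *ᵥ (U *ᵥ η) = U *ᵥ ((A * Aᵀ) *ᵥ η) := by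
      have h : U * A * Vᵀ * (U * A * Vᵀ)ᵀ * U = U * (A * Aᵀ) := by
        calc U * A * Vᵀ * (U * A * Vᵀ)ᵀ * U = U * A * (Vᵀ * V) * Aᵀ * (Uᵀ * U) := by
              simp only [transpose_mul, transpose_transpose, Matrix.mul_assoc]
          _ = U * (A * Aᵀ) := by simp only [hU, hV, Matrix.mul_one, Matrix.mul_assoc]
      rw [mulVec_mulVec, h, ← mulVec_mulVec]
    have hζ : ((U * A * Vᵀ)ᵀ * (U * A * Vᵀ)) *ᵥ (V *ᵥ ζ) = V *ᵥ ((Aᵀ * A) *ᵥ ζ) := by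
      have h : (U * A * Vᵀ)ᵀ * (U * A * Vᵀ) * V = V * (Aᵀ * A) := by
        calc (U * A * Vᵀ)ᵀ * (U * A * Vᵀ) * V = V * Aᵀ * (Uᵀ * U) * A * (Vᵀ * V) := by
              simp only [transpose_mul, transpose_transpose, Matrix.mul_assoc]
          _ = V * (Aᵀ * A) := by simp only [hU, hV, Matrix.mul_one, Matrix.mul_assoc]
      rw [mulVec_mulVec, h, ← mulVec_mulVec]
    have hAζ : (U * A * Vᵀ) *ᵥ (V *ᵥ ζ) = U *ᵥ (A *ᵥ ζ) := by
      rw [mulVec_mulVec, Matrix.mul_assoc, hV, Matrix.mul_one, mulVec_mulVec]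
    have hAη : (U * A * Vᵀ)ᵀ *ᵥ (U *ᵥ η) = V *ᵥ (Aᵀ *ᵥ η) := by
      rw [mulVec_mulVec, transpose_mul, transpose_mul, transpose_transpose, Matrix.mul_assoc,
        Matrix.mul_assoc, hU, Matrix.mul_one, mulVec_mulVec]
    simp only [Cfun, hη, hζ, hAζ, hAη, dot_crossProduct_mulVec, hUdet, hVdet, one_mul]
  · simp only [Cfun, transpose_transpose]
    exact add_comm _ _
  · simp only [Cfun, mulVec_neg, map_neg, LinearMap.neg_apply, neg_neg, dot_neg_right]
    ring
end
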